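/- Every n-player aggregate risk-averse matrix game admits a risk-averse Nash equilibrium. Precisely: suppose for each player i the penalty function D_i : P_{−i} × P_{−i} → ℝ is jointly continuous and is convex in its first argument for each fixed second argument, and define the aggregate risk-averse loss f_i(π_i, π_{−i}) = sup_{p ∈ P_{−i}} ( −π_iᵀ R_i p − D_i(p, π_{−i}) ). Then there exists a joint strategy π* ∈ P such that for every player i and every π_i ∈ Δ_{A_i}, f_i(π_i*, π_{−i}*) ≤ f_i(π_i, π_{−i}*). -/

import Mathlib

open Finset

/-- The space of (concatenations of) opponents' strategy profiles of player `i`: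
one vector in `ℝ^{A j}` for each player `j ≠ i`.  (`P_{−i}` lives inside this space.) -/
abbrev OppProfile (n : ℕ) (A : Fin n → ℕ) (i : Fin n) : Type :=
  ∀ j : {j : Fin n // j ≠ i}, Fin (A j.1) → ℝ

/-- `P_{−i} = ∏_{j ≠ i} Δ_{A_j}`, the product of the opponents' simplices. -/
def OppSimplex (n : ℕ) (A : Fin n → ℕ) (i : Fin n) : Set (OppProfile n A i) :=
  {p | ∀ j, p j ∈ stdSimplex ℝ (Fin (A j.1))}

/-- Index set for the concatenation `ℝ^{A_{−i}}`, `A_{−i} = Σ_{j≠i} A_j`. -/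
abbrev OppIdx (n : ℕ) (A : Fin n → ℕ) (i : Fin n) : Type :=
  Σ j : {j : Fin n // j ≠ i}, Fin (A j.1)

/-- The bilinear pairing `π_iᵀ R_i p` where `R_i ∈ ℝ^{A_i × A_{−i}}` and
`p ∈ P_{−i} ⊆ ℝ^{A_{−i}}` is viewed by concatenation. -/
def bilin (n : ℕ) (A : Fin n → ℕ) (i : Fin n)
    (R : Fin (A i) → OppIdx n A i → ℝ) (x : Fin (A i) → ℝ) (p : OppProfile n A i) : ℝ :=
  ∑ a, ∑ b : OppIdx n A i, x a * R a b * p b.1 b.2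

/-- The restriction `π_{−i}` of a joint strategy profile `π` to the opponents of `i`. -/
def restr (n : ℕ) (A : Fin n → ℕ) (π : ∀ j, Fin (A j) → ℝ) (i : Fin n) :
    OppProfile n A i := fun j => π j.1

/-- The aggregate risk-averse loss
`f_i(π_i, π_{−i}) = sup_{p ∈ P_{−i}} ( −π_iᵀ R_i p − D_i(p, π_{−i}) )`. -/
noncomputable def aggLoss (n : ℕ) (A : Fin n → ℕ)
    (R : ∀ i : Fin n, Fin (A i) → OppIdx n A i → ℝ)
    (D : ∀ i : Fin n, OppProfile n A i → OppProfile n A i → ℝ)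
    (i : Fin n) (π : ∀ j, Fin (A j) → ℝ) : ℝ :=
  sSup ((fun p => -(bilin n A i (R i) (π i) p) - D i p (restr n A π i)) ''
    OppSimplex n A i)

/-- dominance in the sense of Scarf -/
def ScarfDom {U I : Type*} (rk : I → U → ℕ) (s : Finset U) : Prop :=
  ∀ x : U, ∃ i : I, ∀ y ∈ s, rk i x ≤ rk i y

def ScarfM {U I : Type*} (rk : I → U → ℕ) (m : I → U) (i : I) (z : U) : Prop :=
  ∀ k, k ≠ i → rk k (m k) < rk k z

def ScarfTop {U I : Type*} (rk : I → U → ℕ) (m : I → U) (i : I) (x : U) : Prop :=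
  ScarfM rk m i x ∧ ∀ z, ScarfM rk m i z → rk i z ≤ rk i x

lemma ScarfTop.exists {U I : Type*} [Fintype U] (rk : I → U → ℕ)
    (m : I → U) (i : I) (z : U) (h : ScarfM rk m i z) : ∃ x, ScarfTop rk m i x := by
  classical
  obtain ⟨x, hx, hx'⟩ := (univ.filter (fun z => ScarfM rk m i z)).exists_max_image (rk i)
    ⟨z, by simpa using h⟩
  exact ⟨x, by simpa using hx, fun z hz => hx' z (by simpa using hz)⟩

lemma scarf_door {U I : Type*} [Fintype U] [DecidableEq U] [Fintype I] [DecidableEq I]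
    (rk : I → U → ℕ) (hrk : ∀ i, Function.Injective (rk i)) (d : Finset U)
    (hd : ScarfDom rk d) (hcard : d.card + 1 = Fintype.card I) (hne : d.Nonempty) :
    ∃ (m : I → U) (i j : I), i ≠ j ∧ m i = m j ∧ (∀ k, m k ∈ d) ∧
      (∀ k, ∀ y ∈ d, rk k (m k) ≤ rk k y) ∧
      (∀ x, (x ∉ d ∧ ScarfDom rk (insert x d)) ↔ (ScarfTop rk m i x ∨ ScarfTop rk m j x)) ∧
      (∀ x, ScarfTop rk m i x → ¬ ScarfTop rk m j x) := by
  have h1 : ∀ i, ∃ x ∈ d, ∀ y ∈ d, rk i x ≤ rk i y := fun i => d.exists_min_image (rk i) hne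
  choose m hm hmin using h1
  have hsurj : ∀ y ∈ d, ∃ i, m i = y := by
    intro y hy
    obtain ⟨i, hi⟩ := hd y
    exact ⟨i, hrk i (le_antisymm (hmin i y hy) (hi _ (hm i)))⟩
  obtain ⟨i, -, j, -, hij, hmij⟩ := Finset.exists_ne_map_eq_of_card_lt_of_maps_to
    (s := (univ : Finset I)) (t := d) (f := m) (by rw [Finset.card_univ]; omega)
    (fun k _ => hm k)
  have hinj : ∀ a b, a ≠ b → m a = m b → Set.InjOn m ((univ.erase a : Finset I) : Set I) := by
    intro a b hab hmab
    apply Finset.injOn_of_card_image_eq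
    have : (univ.erase a).image m = d := by
      ext y
      simp only [mem_image, mem_erase, mem_univ, and_true]
      constructor
      · rintro ⟨k, -, rfl⟩; exact hm k
      · intro hy
        obtain ⟨k, hk⟩ := hsurj y hy
        by_cases hka : k = a
        · exact ⟨b, hab.symm, by rw [← hk, hka, hmab]⟩
        · exact ⟨k, hka, hk⟩
    rw [this, card_erase_of_mem (mem_univ _), card_univ]; omega
  have hpair : ∀ k l, k ≠ l → m k = m l → (k = i ∧ l = j) ∨ (k = j ∧ l = i) := by
    intro k l hkl hm'
    have a1 : k = i ∨ l = i := by
      by_contra! h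
      exact hkl (hinj i j hij hmij (by simp [h.1]) (by simp [h.2]) hm')
    have a2 : k = j ∨ l = j := by
      by_contra! h
      exact hkl (hinj j i hij.symm hmij.symm (by simp [h.1]) (by simp [h.2]) hm')
    grind
  have key1 : ∀ a b, a ≠ b → m a = m b → ∀ x, ScarfTop rk m a x →
      x ∉ d ∧ ScarfDom rk (insert x d) := by
    intro a b hab hmab x hx
    constructor
    · intro hxd
      obtain ⟨k, hk⟩ := hsurj x hxd
      by_cases hka : k = a
      · have := hx.1 b hab.symm
        rw [← hmab, ← hka, hk] at this
        exact lt_irrefl _ this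
      · have := hx.1 k hka
        rw [hk] at this
        exact lt_irrefl _ this
    · intro z
      by_cases hz : ScarfM rk m a z
      · refine ⟨a, ?_⟩
        obtain ⟨k, hk⟩ := hd z
        have hka : k = a := by
          by_contra hka
          exact absurd (hk _ (hm k)) (not_le.2 (hz k hka))
        subst hka
        intro y hy
        rcases mem_insert.1 hy with rfl | hy
        · exact hx.2 z hz
        · exact hk y hy
      · unfold ScarfM at hz
        push Not at hz
        obtain ⟨k, hka, hk⟩ := hz
        refine ⟨k, ?_⟩
        intro y hy
        rcases mem_insert.1 hy with rfl | hy
        · exact hk.trans (hx.1 k hka).le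
        · exact hk.trans (hmin k y hy)
  have key2 : ∀ a x, ScarfDom rk (insert x d) → ScarfM rk m a x → ScarfTop rk m a x := by
    intro a x hx hM
    refine ⟨hM, fun z hz => ?_⟩
    obtain ⟨k, hk⟩ := hx z
    have hka : k = a := by
      by_contra hka
      exact absurd (hk _ (mem_insert_of_mem (hm k))) (not_le.2 (hz k hka))
    subst hka
    exact hk x (mem_insert_self _ _)
  refine ⟨m, i, j, hij, hmij, hm, hmin, ?_, ?_⟩
  · intro x
    constructor
    · rintro ⟨hxd, hx⟩
      have h3 : ∀ k, ∃ l, m l = m k ∧ rk l (m l) < rk l x := by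
        intro k
        obtain ⟨l, hl⟩ := hx (m k)
        have hlk : m l = m k := hrk l (le_antisymm (hmin l _ (hm k))
          (hl _ (mem_insert_of_mem (hm l))))
        refine ⟨l, hlk, lt_of_le_of_ne ?_ ?_⟩
        · rw [hlk]; exact hl _ (mem_insert_self _ _)
        · intro h
          exact hxd (hrk l h ▸ hm l)
      have h4 : ∀ k, k ≠ i → k ≠ j → rk k (m k) < rk k x := by
        intro k hki hkj
        obtain ⟨l, hl, hl'⟩ := h3 k
        by_cases hlk : l = k
        · rwa [hlk] at hl'
        · rcases hpair l k hlk hl with h | h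
          · exact absurd h.2 hkj
          · exact absurd h.2 hki
      obtain ⟨l, hl, hl'⟩ := h3 i
      by_cases hli : l = i
      · right
        refine key2 j x hx (fun k hk => ?_)
        by_cases hki : k = i
        · rw [hki, ← hli]; exact hl'
        · exact h4 k hki hk
      · left
        rcases hpair l i hli hl with h | h
        · exact absurd h.1 hli
        · refine key2 i x hx (fun k hk => ?_)
          by_cases hkj : k = j
          · rw [hkj, ← h.1]; exact hl'
          · exact h4 k hk hkj
    · rintro (h | h)
      · exact key1 i j hij hmij x h
      · exact key1 j i hij.symm hmij.symm x h
  · intro x hx hx'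
    obtain ⟨k, hk⟩ := hd x
    have h5 := hk _ (hm k)
    by_cases hki : k = i
    · subst hki
      exact absurd h5 (not_le.2 (hx'.1 _ hij))
    · exact absurd h5 (not_le.2 (hx.1 _ hki))

lemma scarf_room {U I : Type*} [DecidableEq U] [Fintype I] [DecidableEq I]
    (c : U → I) (i0 : I) (s : Finset U) (hs : s.card = Fintype.card I) (hc : s.image c ≠ univ) :
    Even (s.filter (fun x => (s.erase x).image c = univ.erase i0)).card := by
  by_cases h : ∃ x ∈ s, (s.erase x).image c = univ.erase i0
  · obtain ⟨x, hx, hxc⟩ := h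
    have hinj : Set.InjOn c ((s.erase x : Finset U) : Set U) := by
      apply Finset.injOn_of_card_image_eq
      rw [hxc, card_erase_of_mem hx, card_erase_of_mem (mem_univ _), hs, card_univ]
    have hcx : c x ≠ i0 := by
      intro h
      apply hc
      rw [← insert_erase hx, image_insert, hxc, h, insert_erase (mem_univ _)]
    have : c x ∈ (s.erase x).image c := by rw [hxc]; simp [hcx]
    obtain ⟨y, hy, hyx⟩ := mem_image.1 this
    have hyx' := mem_erase.1 hy
    have : (s.filter (fun x => (s.erase x).image c = univ.erase i0)) = {x, y} := by
      ext z
      simp only [mem_filter, mem_insert, mem_singleton]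
      constructor
      · rintro ⟨hz, hzc⟩
        by_contra! hn
        have : c z ∈ (s.erase z).image c := by
          rw [hzc, ← hxc]
          exact mem_image_of_mem _ (mem_erase.2 ⟨hn.1, hz⟩)
        obtain ⟨w, hw, hwz⟩ := mem_image.1 this
        have hw' := mem_erase.1 hw
        by_cases hwx : w = x
        · subst hwx
          exact hn.2 (hinj (by simp [hz, hn.1]) (by simp [hyx'.1, hyx'.2]) (by rw [hyx, hwz]))
        · exact hw'.1 (hinj (by simp [hw'.2, hwx]) (by simp [hz, hn.1]) hwz)
      · rintro (rfl | rfl)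
        · exact ⟨hx, hxc⟩
        · refine ⟨hyx'.2, ?_⟩
          rw [← hxc]
          ext i
          simp only [mem_image, mem_erase]
          constructor
          · rintro ⟨w, ⟨hw1, hw2⟩, rfl⟩
            by_cases hwx : w = x
            · exact ⟨z, ⟨hyx'.1, hyx'.2⟩, by rw [hwx, hyx]⟩
            · exact ⟨w, ⟨hwx, hw2⟩, rfl⟩
          · rintro ⟨w, ⟨hw1, hw2⟩, rfl⟩
            by_cases hwz : w = z
            · exact ⟨x, ⟨hyx'.1.symm, hx⟩, by rw [hwz, hyx]⟩
            · exact ⟨w, ⟨hwz, hw2⟩, rfl⟩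
    rw [this, card_pair hyx'.1.symm]
    exact even_two
  · push Not at h
    rw [filter_eq_empty_iff.2 (fun x hx => h x hx)]
    simp

lemma ScarfTop.unique {U I : Type*} (rk : I → U → ℕ) (hrk : ∀ i, Function.Injective (rk i))
    (m : I → U) (i : I) (x y : U) (hx : ScarfTop rk m i x) (hy : ScarfTop rk m i y) : x = y :=
  hrk i (le_antisymm (hy.2 _ hx.1) (hx.2 _ hy.1))

lemma ScarfDom.mono {U I : Type*} {rk : I → U → ℕ} {s t : Finset U} (h : s ⊆ t)
    (ht : ScarfDom rk t) : ScarfDom rk s := fun x => by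
  obtain ⟨i, hi⟩ := ht x
  exact ⟨i, fun y hy => hi y (h hy)⟩

lemma scarf {U I : Type*} [Fintype U] [DecidableEq U] [Fintype I] [DecidableEq I] [Nontrivial I]
    (rk : I → U → ℕ) (hrk : ∀ i, Function.Injective (rk i)) (e : I → U)
    (hmin : ∀ i u, u ≠ e i → rk i (e i) < rk i u)
    (hbig : ∀ i k u, k ≠ i → (∀ j, u ≠ e j) → rk k u < rk k (e i))
    (c : U → I) (hc : ∀ i, c (e i) = i) :
    ∃ s : Finset U, s.card = Fintype.card I ∧ ScarfDom rk s ∧ s.image c = univ := by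
  classical
  by_contra hcon
  push Not at hcon
  obtain ⟨i0⟩ : Nonempty I := inferInstance
  have heinj : Function.Injective e := fun a b h => by rw [← hc a, h, hc]
  -- incidences
  let Q : Finset (Finset U × U) := univ.filter (fun p =>
    p.2 ∉ p.1 ∧ p.1.image c = univ.erase i0 ∧ p.1.card + 1 = Fintype.card I ∧
      ScarfDom rk (insert p.2 p.1))
  have hQ1 : Even Q.card := by
    have hmap : ∀ p ∈ Q, insert p.2 p.1 ∈ (univ.filter (fun s : Finset U =>
        s.card = Fintype.card I ∧ ScarfDom rk s)) := by
      rintro ⟨d, x⟩ hp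
      simp only [Q, mem_filter, mem_univ, true_and] at hp ⊢
      exact ⟨by rw [card_insert_of_notMem hp.1]; exact hp.2.2.1, hp.2.2.2⟩
    rw [card_eq_sum_card_fiberwise hmap]
    apply Finset.even_sum
    intro s hs
    simp only [mem_filter, mem_univ, true_and] at hs
    have := scarf_room c i0 s hs.1 (hcon s hs.1 hs.2)
    refine (congrArg Even ?_).mpr this
    refine Finset.card_bij' (fun p _ => p.2) (fun x _ => (s.erase x, x)) ?_ ?_ ?_ ?_
    · rintro ⟨d, x⟩ hp
      simp only [Q, mem_filter, mem_univ, true_and] at hp ⊢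
      obtain ⟨⟨h1, h2, h3, h4⟩, rfl⟩ := hp
      simp [erase_insert h1, h2]
    · intro x hx
      simp only [Q, mem_filter, mem_univ, true_and] at hx ⊢
      refine ⟨⟨by simp, hx.2, ?_, ?_⟩, insert_erase hx.1⟩
      · rw [card_erase_add_one hx.1, hs.1]
      · rw [insert_erase hx.1]; exact hs.2
    · rintro ⟨d, x⟩ hp
      simp only [Q, mem_filter, mem_univ, true_and] at hp ⊢
      obtain ⟨⟨h1, h2, h3, h4⟩, rfl⟩ := hp
      simp [erase_insert h1]
    · intro x hx
      rfl
  let Dr : Finset (Finset U) := univ.filter (fun d => d.image c = univ.erase i0 ∧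
      d.card + 1 = Fintype.card I ∧ ScarfDom rk d)
  let d0 : Finset U := (univ.erase i0).image e
  have hd0 : d0 ∈ Dr := by
    simp only [Dr, d0, mem_filter, mem_univ, true_and]
    refine ⟨?_, ?_, ?_⟩
    · rw [image_image]
      have : c ∘ e = id := funext hc
      rw [this, image_id]
    · rw [card_image_of_injective _ heinj, card_erase_add_one (mem_univ _), card_univ]
    · intro x
      by_cases hx : ∃ j, x = e j
      · obtain ⟨j, rfl⟩ := hx
        refine ⟨j, fun y _ => ?_⟩
        by_cases h : y = e j
        · rw [h]
        · exact (hmin j y h).le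
      · push Not at hx
        refine ⟨i0, fun y hy => ?_⟩
        obtain ⟨k, hk, rfl⟩ := mem_image.1 hy
        exact (hbig k i0 x (by simpa using (ne_of_mem_erase hk).symm) hx).le
  have hne : ∀ d ∈ Dr, d.Nonempty := by
    intro d hd
    simp only [Dr, mem_filter, mem_univ, true_and] at hd
    rw [← card_pos]
    have := Fintype.one_lt_card (α := I)
    omega
  have hQ2 : Q.card = ∑ d ∈ Dr, (univ.filter (fun x => x ∉ d ∧ ScarfDom rk (insert x d))).card := by
    have hmap : ∀ p ∈ Q, p.1 ∈ Dr := by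
      rintro ⟨d, x⟩ hp
      simp only [Q, Dr, mem_filter, mem_univ, true_and] at hp ⊢
      exact ⟨hp.2.1, hp.2.2.1, hp.2.2.2.mono (subset_insert _ _)⟩
    rw [card_eq_sum_card_fiberwise hmap]
    apply sum_congr rfl
    intro d hd
    simp only [Dr, mem_filter, mem_univ, true_and] at hd
    refine Finset.card_bij' (fun p _ => p.2) (fun x _ => (d, x)) ?_ ?_ ?_ ?_
    · rintro ⟨d', x⟩ hp
      simp only [Q, mem_filter, mem_univ, true_and] at hp ⊢
      obtain ⟨⟨h1, h2, h3, h4⟩, rfl⟩ := hp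
      exact ⟨h1, h4⟩
    · intro x hx
      simp only [Q, mem_filter, mem_univ, true_and] at hx ⊢
      exact ⟨⟨hx.1, hd.1, hd.2.1, hx.2⟩, trivial⟩
    · rintro ⟨d', x⟩ hp
      simp only [Q, mem_filter, mem_univ, true_and] at hp ⊢
      obtain ⟨⟨h1, h2, h3, h4⟩, rfl⟩ := hp
      rfl
    · intro x hx
      rfl
  rw [← add_sum_erase _ _ hd0] at hQ2
  have hE : Even (∑ d ∈ Dr.erase d0,
      (univ.filter (fun x => x ∉ d ∧ ScarfDom rk (insert x d))).card) := by
    apply Finset.even_sum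
    intro d hd
    have hdd := mem_erase.1 hd
    have hdn := hne d hdd.2
    have hd' := hdd.2
    simp only [Dr, mem_filter, mem_univ, true_and] at hd'
    obtain ⟨m, i, j, hij, hmij, hm, hmm, hiff, hex⟩ := scarf_door rk hrk d hd'.2.2 hd'.2.1 hdn
    have hu : ∃ u ∈ d, ∀ j, u ≠ e j := by
      by_contra! h
      apply hdd.1
      apply eq_of_subset_of_card_le
      · intro u hu
        obtain ⟨k, rfl⟩ := h u hu
        apply mem_image_of_mem
        rw [← hd'.1]
        exact mem_image.2 ⟨_, hu, hc k⟩
      · have := hd'.2.1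
        simp only [d0]
        rw [card_image_of_injective _ heinj, card_erase_of_mem (mem_univ _), card_univ]
        omega
    obtain ⟨u, hud, hu⟩ := hu
    have hM : ∀ i, ScarfM rk m i (e i) := fun i k hk =>
      (hmm k u hud).trans_lt (hbig i k u hk hu)
    obtain ⟨x, hx⟩ := ScarfTop.exists rk m i _ (hM i)
    obtain ⟨y, hy⟩ := ScarfTop.exists rk m j _ (hM j)
    have : (univ.filter (fun x => x ∉ d ∧ ScarfDom rk (insert x d))) = {x, y} := by
      ext z
      simp only [mem_filter, mem_univ, true_and, mem_insert, mem_singleton]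
      rw [hiff]
      constructor
      · rintro (h | h)
        · left; exact ScarfTop.unique rk hrk m i _ _ h hx
        · right; exact ScarfTop.unique rk hrk m j _ _ h hy
      · rintro (rfl | rfl)
        · exact Or.inl hx
        · exact Or.inr hy
    rw [this, card_pair]
    · exact even_two
    · rintro rfl
      exact hex x hx hy
  have hO : (univ.filter (fun x => x ∉ d0 ∧ ScarfDom rk (insert x d0))).card = 1 := by
    have hdn := hne d0 hd0
    have hd' := hd0
    simp only [Dr, mem_filter, mem_univ, true_and] at hd'
    obtain ⟨m, i, j, hij, hmij, hm, hmm, hiff, hex⟩ := scarf_door rk hrk d0 hd'.2.2 hd'.2.1 hdn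
    have hme : ∀ k, k ≠ i0 → m k = e k := by
      intro k hk
      by_contra h
      exact absurd (hmm k (e k) (mem_image_of_mem _ (by simp [hk]))) (not_le.2 (hmin k _ h))
    have hM : ScarfM rk m i0 (e i0) := by
      intro k hk
      rw [hme k hk]
      exact hmin k _ (fun h => hk (heinj h).symm)
    obtain ⟨x, hx⟩ := ScarfTop.exists rk m i0 _ hM
    have hno : ∀ a, a ≠ i0 → m a = m i0 → ∀ z, ¬ ScarfTop rk m a z := by
      intro a ha hma z hz
      have h0 := hz.1 i0 ha.symm
      rw [← hma, hme a ha] at h0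
      by_cases hze : ∃ l, z = e l
      · obtain ⟨l, rfl⟩ := hze
        by_cases hla : l = a
        · rw [hla] at h0; exact lt_irrefl _ h0
        · by_cases hl0 : l = i0
          · rw [hl0] at h0
            exact lt_asymm h0 (hmin i0 _ (fun h => ha (heinj h)))
          · have := hz.1 l hla
            rw [hme l hl0] at this
            exact lt_irrefl _ this
      · push Not at hze
        exact lt_asymm h0 (hbig a i0 z ha.symm hze)
    rw [card_eq_one]
    refine ⟨x, ?_⟩
    have hij0 : i = i0 ∨ j = i0 := by
      by_contra! h
      rw [hme i h.1, hme j h.2] at hmij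
      exact hij (heinj hmij)
    ext z
    simp only [mem_filter, mem_univ, true_and, mem_singleton]
    rw [hiff]
    have hxu : z = x ↔ ScarfTop rk m i0 z :=
      ⟨fun h => h ▸ hx, fun h => ScarfTop.unique rk hrk m i0 _ _ h hx⟩
    rw [hxu]
    rcases hij0 with rfl | rfl
    · have := hno j hij.symm hmij.symm z
      tauto
    · have := hno i hij hmij z
      tauto
  rw [hO] at hQ2
  rw [hQ2] at hQ1
  rw [Nat.even_iff] at hQ1 hE
  omega

abbrev BGrid (I : Type*) [Fintype I] (N : ℕ) : Type _ :=
  {v : I → Fin (N + 1) // ∑ i, (v i : ℕ) = N}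

def bLvl {I : Type*} [Fintype I] [DecidableEq I] (N : ℕ) (i : I) : BGrid I N ⊕ I → ℕ
  | Sum.inl v => v.1 i + 1
  | Sum.inr j => if j = i then 0 else N + 2

lemma brouwer_approx {I : Type*} [Fintype I] [DecidableEq I] [Nontrivial I]
    (g : (I → ℝ) → (I → ℝ)) (hg : ∀ x ∈ stdSimplex ℝ I, g x ∈ stdSimplex ℝ I)
    (N : ℕ) (hN : 0 < N) :
    ∃ x ∈ stdSimplex ℝ I, ∀ i, ∃ y ∈ stdSimplex ℝ I,
      (∀ k, |x k - y k| ≤ (Fintype.card I : ℝ) / N) ∧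
      y i ≤ g y i + (Fintype.card I : ℝ) / N := by
  classical
  have hN' : (0 : ℝ) < N := by exact_mod_cast hN
  have hcol : ∀ x ∈ stdSimplex ℝ I, ∃ i, x i ≤ g x i := by
    intro x hx
    by_contra! h
    have h1 : ∑ i, g x i < ∑ i, x i := sum_lt_sum_of_nonempty univ_nonempty (fun i _ => h i)
    rw [hx.2, (hg x hx).2] at h1
    exact lt_irrefl _ h1
  let pt : BGrid I N → I → ℝ := fun v i => ((v.1 i : ℕ) : ℝ) / N
  have hpt : ∀ v, pt v ∈ stdSimplex ℝ I := by
    intro v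
    refine ⟨fun i => by positivity, ?_⟩
    simp only [pt]
    rw [← sum_div, ← Nat.cast_sum, v.2]
    field_simp
  choose! col hcol using hcol
  let U := BGrid I N ⊕ I
  let K := Fintype.card U
  let en : U ≃ Fin K := Fintype.equivFin U
  let rk : I → U → ℕ := fun i u => bLvl N i u * K + en u
  have hlt : ∀ i u v, bLvl N i u < bLvl N i v → rk i u < rk i v := by
    intro i u v h
    simp only [rk]
    have h1 := (en u).2
    have h2 : (bLvl N i u + 1) * K ≤ bLvl N i v * K := Nat.mul_le_mul_right _ h
    rw [add_mul] at h2
    omega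
  have hle : ∀ i u v, rk i u ≤ rk i v → bLvl N i u ≤ bLvl N i v := by
    intro i u v h
    by_contra! h'
    exact absurd (hlt i v u h') (not_lt.2 h)
  have hrk : ∀ i, Function.Injective (rk i) := by
    intro i u v h
    have h1 := le_antisymm (hle i u v h.le) (hle i v u h.ge)
    simp only [rk] at h
    rw [h1] at h
    exact en.injective (Fin.ext (by omega))
  let c : U → I := Sum.elim (fun v => col (pt v)) id
  obtain ⟨s, hs, hdom, hsc⟩ := scarf rk hrk (fun i => (Sum.inr i : U))
    (by
      intro i u hu
      apply hlt
      rcases u with v | j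
      · simp [bLvl]
      · have : j ≠ i := fun h => hu (by rw [h])
        simp [bLvl, this])
    (by
      intro i k u hki hu
      apply hlt
      rcases u with v | j
      · have := (v.1 k).2
        simp only [bLvl, if_neg hki.symm]
        omega
      · exact absurd rfl (hu j))
    c (fun i => rfl)
  have hdom' : ∀ v : BGrid I N, ∃ i, Sum.inr i ∉ s ∧
      ∀ w : BGrid I N, Sum.inl w ∈ s → (v.1 i : ℕ) ≤ w.1 i := by
    intro v
    obtain ⟨i, hi⟩ := hdom (Sum.inl v)
    refine ⟨i, fun h => ?_, fun w hw => ?_⟩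
    · have := hle _ _ _ (hi _ h)
      simp [bLvl] at this
    · have := hle _ _ _ (hi _ hw)
      simpa [bLvl] using this
  let C : Finset I := univ.filter (fun i => Sum.inr i ∉ s)
  have hCpt : ∀ i ∈ C, ∃ v : BGrid I N, Sum.inl v ∈ s ∧ pt v i ≤ g (pt v) i := by
    intro i hi
    have : i ∈ s.image c := by rw [hsc]; exact mem_univ _
    obtain ⟨u, hu, rfl⟩ := mem_image.1 this
    rcases u with v | j
    · exact ⟨v, hu, hcol _ (hpt v)⟩
    · exact absurd hu (by simpa [C, c] using hi)
  obtain ⟨i1, hi1⟩ : C.Nonempty := by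
    obtain ⟨i⟩ : Nonempty I := inferInstance
    obtain ⟨j, hj, -⟩ := hdom' ⟨fun k => if k = i then Fin.last N else 0, by
      rw [Finset.sum_eq_single i] <;> simp +contextual⟩
    exact ⟨j, by simpa [C] using hj⟩
  let S : Finset (BGrid I N) := univ.filter (fun v => Sum.inl v ∈ s)
  obtain ⟨v0, hv0, -⟩ := hCpt i1 hi1
  have hmu : ∀ i, ∃ v ∈ S, ∀ w ∈ S, (v.1 i : ℕ) ≤ w.1 i := fun i =>
    S.exists_min_image (fun v => (v.1 i : ℕ)) ⟨v0, by simpa [S] using hv0⟩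
  choose mv hmvS hmv using hmu
  let μ : I → ℕ := fun i => (mv i).1 i
  have hsum : N < ∑ i ∈ C, (μ i + 1) := by
    by_contra! hcon
    let w : I → ℕ := fun i => (if i ∈ C then μ i + 1 else 0) +
      (if i = i1 then N - ∑ i ∈ C, (μ i + 1) else 0)
    have hw : ∑ i, w i = N := by
      simp only [w]
      rw [sum_add_distrib, sum_ite_mem, univ_inter, sum_ite_eq' univ i1]
      simp only [mem_univ, if_true]
      omega
    have hwN : ∀ i, w i < N + 1 := by
      intro i
      have := single_le_sum (f := w) (fun _ _ => Nat.zero_le _) (mem_univ i)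
      omega
    obtain ⟨i, hi, hi'⟩ := hdom' ⟨fun i => ⟨w i, hwN i⟩, hw⟩
    have h1 := hi' (mv i) (by simpa [S] using hmvS i)
    have hiC : i ∈ C := by simpa [C] using hi
    simp only [w, if_pos hiC] at h1
    simp only [μ] at h1
    omega
  rw [sum_add_distrib, sum_const, smul_eq_mul, mul_one] at hsum
  have hCcard : C.card ≤ Fintype.card I := card_le_univ C
  have hbd1 : ∀ v ∈ S, ∀ i ∈ C, (v.1 i : ℕ) ≤ μ i + Fintype.card I := by
    intro v hv i hi
    have h1 : ∑ k ∈ C, (v.1 k : ℕ) ≤ N :=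
      (sum_le_univ_sum_of_nonneg (fun _ => Nat.zero_le _)).trans v.2.le
    rw [← add_sum_erase _ _ hi] at h1 hsum
    have h2 : ∑ k ∈ C.erase i, μ k ≤ ∑ k ∈ C.erase i, (v.1 k : ℕ) :=
      sum_le_sum (fun k _ => hmv k v hv)
    omega
  have hbd2 : ∀ v ∈ S, ∀ i, i ∉ C → (v.1 i : ℕ) ≤ Fintype.card I := by
    intro v hv i hi
    have h1 : ∑ k ∈ insert i C, (v.1 k : ℕ) ≤ N :=
      (sum_le_univ_sum_of_nonneg (fun _ => Nat.zero_le _)).trans v.2.le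
    rw [sum_insert hi] at h1
    have h2 : ∑ k ∈ C, μ k ≤ ∑ k ∈ C, (v.1 k : ℕ) :=
      sum_le_sum (fun k _ => hmv k v hv)
    omega
  have hbd : ∀ v ∈ S, ∀ w ∈ S, ∀ i, (v.1 i : ℕ) ≤ w.1 i + Fintype.card I := by
    intro v hv w hw i
    by_cases hi : i ∈ C
    · exact (hbd1 v hv i hi).trans (Nat.add_le_add_right (hmv i w hw) _)
    · exact (hbd2 v hv i hi).trans (Nat.le_add_left _ _)
  have hbdR : ∀ v ∈ S, ∀ w ∈ S, ∀ i, |pt v i - pt w i| ≤ (Fintype.card I : ℝ) / N := by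
    intro v hv w hw i
    simp only [pt]
    rw [← sub_div, abs_div, abs_of_pos hN']
    apply div_le_div_of_nonneg_right _ hN'.le
    have h1 : ((v.1 i : ℕ) : ℝ) ≤ ((w.1 i : ℕ) : ℝ) + Fintype.card I := by
      exact_mod_cast hbd v hv w hw i
    have h2 : ((w.1 i : ℕ) : ℝ) ≤ ((v.1 i : ℕ) : ℝ) + Fintype.card I := by
      exact_mod_cast hbd w hw v hv i
    rw [abs_le]; constructor <;> linarith
  have hv0S : v0 ∈ S := by simpa [S] using hv0
  have hpos : 0 ≤ (Fintype.card I : ℝ) / N := by positivity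
  refine ⟨pt v0, hpt v0, fun i => ?_⟩
  by_cases hi : i ∈ C
  · obtain ⟨v, hv, hvi⟩ := hCpt i hi
    exact ⟨pt v, hpt v, hbdR _ hv0S _ (by simpa [S] using hv), by linarith⟩
  · refine ⟨pt v0, hpt v0, fun k => by simpa using hpos, ?_⟩
    have h1 := (hg _ (hpt v0)).1 i
    have h2 : pt v0 i ≤ (Fintype.card I : ℝ) / N := by
      simp only [pt]
      apply div_le_div_of_nonneg_right _ hN'.le
      exact_mod_cast hbd2 v0 hv0S i hi
    linarith

lemma brouwer_simplex {I : Type*} [Fintype I] [DecidableEq I] [Nonempty I]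
    (g : (I → ℝ) → (I → ℝ)) (hg : ∀ x ∈ stdSimplex ℝ I, g x ∈ stdSimplex ℝ I)
    (hcont : ContinuousOn g (stdSimplex ℝ I)) : ∃ x ∈ stdSimplex ℝ I, g x = x := by
  rcases subsingleton_or_nontrivial I with hI | hI
  · obtain ⟨i⟩ := ‹Nonempty I›
    have h0 : Pi.single i (1 : ℝ) ∈ stdSimplex ℝ I := single_mem_stdSimplex ℝ i
    refine ⟨_, h0, ?_⟩
    have huniq : ∀ x ∈ stdSimplex ℝ I, ∀ j, x j = 1 := by
      intro x hx j
      have := hx.2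
      rwa [Fintype.sum_subsingleton _ j] at this
    funext j
    rw [huniq _ (hg _ h0), huniq _ h0]
  · have h := fun N : ℕ => brouwer_approx g hg (N + 1) N.succ_pos
    choose x hx y hy hxy hyg using h
    obtain ⟨a, ha, φ, hφ, hlim⟩ := (isCompact_stdSimplex ℝ I).tendsto_subseq hx
    have hsmall : Filter.Tendsto (fun N : ℕ => (Fintype.card I : ℝ) / ((N + 1 : ℕ) : ℝ))
        Filter.atTop (nhds 0) :=
      (tendsto_const_div_atTop_nhds_zero_nat _).comp (Filter.tendsto_add_atTop_nat 1)
    have hsmall' := hsmall.comp hφ.tendsto_atTop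
    have hylim : ∀ i, Filter.Tendsto (fun N => y (φ N) i) Filter.atTop (nhds a) := by
      intro i
      rw [tendsto_pi_nhds]
      intro k
      have h1 := (tendsto_pi_nhds.1 hlim) k
      have h2 : Filter.Tendsto (fun N => x (φ N) k - y (φ N) i k) Filter.atTop (nhds 0) :=
        squeeze_zero_norm (fun N => hxy (φ N) i k) hsmall'
      have h3 := h1.sub h2
      simpa using h3
    have hle : ∀ i, a i ≤ g a i := by
      intro i
      have h1 := (tendsto_pi_nhds.1 (hylim i)) i
      have h2 : Filter.Tendsto (fun N => g (y (φ N) i)) Filter.atTop (nhds (g a)) :=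
        (hcont a ha).tendsto.comp
          (tendsto_nhdsWithin_iff.2 ⟨hylim i, Filter.Eventually.of_forall fun N => hy _ _⟩)
      have h3 := ((tendsto_pi_nhds.1 h2) i).add hsmall'
      rw [add_zero] at h3
      exact le_of_tendsto_of_tendsto' h1 h3 (fun N => hyg (φ N) i)
    refine ⟨a, ha, ?_⟩
    have hs : ∑ i, a i = ∑ i, g a i := by rw [ha.2, (hg a ha).2]
    have := (sum_eq_sum_iff_of_le (fun i _ => hle i)).1 hs
    funext i
    exact (this i (mem_univ i)).symm

lemma ky_fan {E : Type*} [AddCommGroup E] [Module ℝ E] [TopologicalSpace E] [T2Space E]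
    [ContinuousAdd E] [ContinuousSMul ℝ E] (P : Set E) (hP : IsCompact P) (hPc : Convex ℝ P)
    (hPne : P.Nonempty) (Φ : E → E → ℝ)
    (hcont : ∀ y ∈ P, ContinuousOn (fun x => Φ x y) P)
    (hconv : ∀ x ∈ P, ConvexOn ℝ P (Φ x)) (hdiag : ∀ x ∈ P, 0 ≤ Φ x x) :
    ∃ x ∈ P, ∀ y ∈ P, 0 ≤ Φ x y := by
  classical
  have hmain := hP.inter_iInter_nonempty (fun y : P => P ∩ (fun x => Φ x y) ⁻¹' Set.Ici 0)
    (fun y => (hcont y y.2).preimage_isClosed_of_isClosed hP.isClosed isClosed_Ici) ?_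
  · obtain ⟨x, hx, hx'⟩ := hmain
    refine ⟨x, hx, fun y hy => ?_⟩
    exact (Set.mem_iInter.1 hx' ⟨y, hy⟩).2
  intro u
  rcases u.eq_empty_or_nonempty with rfl | hu
  · simpa using hPne
  haveI : Nonempty u := hu.to_subtype
  let X : (u → ℝ) → E := fun l => ∑ j : u, l j • ((j : P) : E)
  have hX : Continuous X := by fun_prop
  have hXP : ∀ l ∈ stdSimplex ℝ u, X l ∈ P := fun l hl =>
    hPc.sum_mem (fun j _ => hl.1 j) hl.2 (fun j _ => (j : P).2)
  let r : (u → ℝ) → u → ℝ := fun l j => max 0 (-Φ (X l) ((j : P) : E))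
  have hr : ContinuousOn r (stdSimplex ℝ u) := by
    rw [continuousOn_pi]
    intro j
    have : ContinuousOn (fun l => Φ (X l) ((j : P) : E)) (stdSimplex ℝ u) :=
      (hcont _ (j : P).2).comp hX.continuousOn hXP
    exact continuousOn_const.sup this.neg
  have hr0 : ∀ l j, 0 ≤ r l j := fun l j => le_max_left _ _
  have hr0' : ∀ l, 0 ≤ ∑ j, r l j := fun l => sum_nonneg fun j _ => hr0 l j
  let g : (u → ℝ) → u → ℝ := fun l j => (l j + r l j) / (1 + ∑ k, r l k)
  have hden : ∀ l, (0 : ℝ) < 1 + ∑ k, r l k := fun l => by linarith [hr0' l]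
  obtain ⟨l, hl, hfix⟩ := brouwer_simplex g
    (by
      intro l hl
      refine ⟨fun j => div_nonneg (add_nonneg (hl.1 j) (hr0 l j)) (hden l).le, ?_⟩
      simp only [g]
      rw [← sum_div, sum_add_distrib, hl.2, div_self (hden l).ne'])
    (by
      have hrj : ∀ j, ContinuousOn (fun l => r l j) (stdSimplex ℝ u) := continuousOn_pi.1 hr
      rw [continuousOn_pi]
      intro j
      refine ContinuousOn.div ?_ ?_ (fun l _ => (hden l).ne')
      · exact (continuous_apply j).continuousOn.add (hrj j)
      · exact continuousOn_const.add (continuousOn_finsetSum _ fun k _ => hrj k))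
  have hj : ∀ j, l j * ∑ k, r l k = r l j := by
    intro j
    have := congrFun hfix j
    simp only [g] at this
    rw [div_eq_iff (hden l).ne'] at this
    linarith
  have hJ : 0 ≤ ∑ j : u, l j * Φ (X l) ((j : P) : E) := by
    have h1 := (hconv (X l) (hXP l hl)).map_sum_le (t := univ) (w := l)
      (p := fun j : u => ((j : P) : E)) (fun j _ => hl.1 j) hl.2 (fun j _ => (j : P).2)
    exact (hdiag _ (hXP l hl)).trans h1
  have hS : ∑ k, r l k = 0 := by
    by_contra hne
    have hpos : 0 < ∑ k, r l k := lt_of_le_of_ne (hr0' l) (Ne.symm hne)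
    have hterm : ∀ j : u, l j * Φ (X l) ((j : P) : E) ≤ 0 ∧
        (0 < l j → l j * Φ (X l) ((j : P) : E) < 0) := by
      intro j
      have key : 0 < l j → l j * Φ (X l) ((j : P) : E) < 0 := by
        intro hlj
        have h1 : 0 < r l j := by rw [← hj j]; positivity
        have h2 : 0 < -Φ (X l) ((j : P) : E) := by
          rcases lt_max_iff.1 h1 with h | h
          · exact absurd h (lt_irrefl _)
          · exact h
        exact mul_neg_of_pos_of_neg hlj (by linarith)
      refine ⟨?_, key⟩
      rcases (hl.1 j).eq_or_lt with h | h
      · rw [← h]; simp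
      · exact (key h).le
    obtain ⟨j, -, hjp⟩ : ∃ j ∈ univ, 0 < l j := by
      apply exists_lt_of_sum_lt (f := fun _ => (0 : ℝ))
      rw [hl.2]; simp
    have : ∑ j : u, l j * Φ (X l) ((j : P) : E) < ∑ j : u, (0 : ℝ) :=
      sum_lt_sum (fun j _ => (hterm j).1) ⟨j, mem_univ _, (hterm j).2 hjp⟩
    rw [sum_const_zero] at this
    linarith
  refine ⟨X l, hXP l hl, ?_⟩
  simp only [Set.mem_iInter]
  intro y hy
  refine ⟨hXP l hl, ?_⟩
  have h0 := (sum_eq_zero_iff_of_nonneg (fun j _ => hr0 l j)).1 hS ⟨y, hy⟩ (mem_univ _)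
  have h1 : -Φ (X l) (y : E) ≤ r l ⟨y, hy⟩ := le_max_right _ _
  simp only [Set.mem_preimage, Set.mem_Ici]
  linarith

/-- the loss as a function of own strategy and opponents' profile -/
noncomputable def lossF (n : ℕ) (A : Fin n → ℕ)
    (R : ∀ i : Fin n, Fin (A i) → OppIdx n A i → ℝ)
    (D : ∀ i : Fin n, OppProfile n A i → OppProfile n A i → ℝ)
    (i : Fin n) (x : Fin (A i) → ℝ) (q : OppProfile n A i) : ℝ :=
  sSup ((fun p => -(bilin n A i (R i) x p) - D i p q) '' OppSimplex n A i)

lemma oppSimplex_compact (n : ℕ) (A : Fin n → ℕ) (i : Fin n) : IsCompact (OppSimplex n A i) := by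
  have : OppSimplex n A i = Set.pi Set.univ
      (fun j : {j : Fin n // j ≠ i} => stdSimplex ℝ (Fin (A j.1))) := by
    ext p; simp [OppSimplex]
  rw [this]
  exact isCompact_univ_pi fun j => isCompact_stdSimplex ℝ _

lemma oppSimplex_nonempty (n : ℕ) (A : Fin n → ℕ) (hA : ∀ i, 1 ≤ A i) (i : Fin n) :
    (OppSimplex n A i).Nonempty :=
  ⟨fun j => Pi.single ⟨0, hA j.1⟩ 1, fun _ => single_mem_stdSimplex ℝ _⟩

lemma bilin_cont (n : ℕ) (A : Fin n → ℕ) (i : Fin n) (R : Fin (A i) → OppIdx n A i → ℝ) :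
    Continuous (fun z : (Fin (A i) → ℝ) × OppProfile n A i => bilin n A i R z.1 z.2) := by
  unfold bilin
  fun_prop

lemma bilin_comb (n : ℕ) (A : Fin n → ℕ) (i : Fin n) (R : Fin (A i) → OppIdx n A i → ℝ)
    (a b : ℝ) (x y : Fin (A i) → ℝ) (p : OppProfile n A i) :
    bilin n A i R (a • x + b • y) p = a * bilin n A i R x p + b * bilin n A i R y p := by
  unfold bilin
  simp only [Pi.add_apply, Pi.smul_apply, smul_eq_mul, mul_sum, ← sum_add_distrib]
  refine sum_congr rfl fun _ _ => sum_congr rfl fun _ _ => by ring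

theorem exists_risk_averse_nash_aggregate
    (n : ℕ) (hn : 2 ≤ n) (A : Fin n → ℕ) (hA : ∀ i, 1 ≤ A i)
    (R : ∀ i : Fin n, Fin (A i) → OppIdx n A i → ℝ)
    (D : ∀ i : Fin n, OppProfile n A i → OppProfile n A i → ℝ)
    (hDcont : ∀ i, ContinuousOn (fun q : OppProfile n A i × OppProfile n A i => D i q.1 q.2)
      (OppSimplex n A i ×ˢ OppSimplex n A i))
    (hDconv : ∀ i, ∀ q ∈ OppSimplex n A i,
      ConvexOn ℝ (OppSimplex n A i) (fun p => D i p q)) :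
    ∃ π : ∀ j, Fin (A j) → ℝ,
      (∀ j, π j ∈ stdSimplex ℝ (Fin (A j))) ∧
      ∀ i : Fin n, ∀ x ∈ stdSimplex ℝ (Fin (A i)),
        aggLoss n A R D i π ≤ aggLoss n A R D i (Function.update π i x) := by
  classical
  let P : Set (∀ j, Fin (A j) → ℝ) := Set.pi Set.univ (fun j => stdSimplex ℝ (Fin (A j)))
  have hPmem : ∀ π, π ∈ P ↔ ∀ j, π j ∈ stdSimplex ℝ (Fin (A j)) := by
    intro π; simp [P]
  have hPr : ∀ π ∈ P, ∀ i, restr n A π i ∈ OppSimplex n A i :=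
    fun π hπ i j => (hPmem π).1 hπ j.1
  have hPcomp : IsCompact P := isCompact_univ_pi fun j => isCompact_stdSimplex ℝ _
  have hPconv : Convex ℝ P := convex_pi fun j _ => convex_stdSimplex ℝ _
  have hPne : P.Nonempty :=
    ⟨fun j => Pi.single ⟨0, hA j⟩ 1, (hPmem _).2 fun _ => single_mem_stdSimplex ℝ _⟩
  have hLcont : ∀ i (h : (∀ j, Fin (A j) → ℝ) → Fin (A i) → ℝ), Continuous h →
      ContinuousOn (fun π => lossF n A R D i (h π) (restr n A π i)) P := by
    intro i h hh
    rw [continuousOn_iff_continuous_domRestrict]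
    haveI : CompactSpace (OppSimplex n A i) :=
      isCompact_iff_compactSpace.1 (oppSimplex_compact n A i)
    have hrc : Continuous (fun π : (∀ j, Fin (A j) → ℝ) => restr n A π i) := by
      unfold restr; fun_prop
    have key := IsCompact.continuous_sSup (K := (Set.univ : Set (OppSimplex n A i)))
      (f := fun (π : P) (p : OppSimplex n A i) =>
        -(bilin n A i (R i) (h π) p) - D i p (restr n A π i)) isCompact_univ (by
        have h1 : Continuous (fun z : P × OppSimplex n A i =>
            bilin n A i (R i) (h z.1) z.2) :=
          (bilin_cont n A i (R i)).comp
            ((hh.comp (continuous_subtype_val.comp continuous_fst)).prodMk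
              (continuous_subtype_val.comp continuous_snd))
        have h2 : Continuous (fun z : P × OppSimplex n A i =>
            D i z.2 (restr n A z.1 i)) :=
          (hDcont i).comp_continuous
            (f := fun z : P × OppSimplex n A i => ((z.2 : OppProfile n A i), restr n A z.1 i))
            ((continuous_subtype_val.comp continuous_snd).prodMk
              (hrc.comp (continuous_subtype_val.comp continuous_fst)))
            (fun z => ⟨z.2.2, hPr _ z.1.2 i⟩)
        exact h1.neg.sub h2)
    refine (congrArg Continuous ?_).mpr key
    funext π
    change sSup _ = sSup _
    congr 1
    ext r
    simp
  have hbdd : ∀ i x, ∀ q ∈ OppSimplex n A i,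
      BddAbove ((fun p => -(bilin n A i (R i) x p) - D i p q) '' OppSimplex n A i) := by
    intro i x q hq
    apply (oppSimplex_compact n A i).bddAbove_image
    apply ContinuousOn.sub
    · exact ((bilin_cont n A i (R i)).comp
        (continuous_const.prodMk continuous_id)).neg.continuousOn
    · exact (hDcont i).comp (f := fun p => (p, q))
        (continuous_id.prodMk continuous_const).continuousOn (fun p hp => ⟨hp, hq⟩)
  have hLconv : ∀ i, ∀ q ∈ OppSimplex n A i, ConvexOn ℝ P (fun y => lossF n A R D i (y i) q) := by
    intro i q hq
    refine ⟨hPconv, ?_⟩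
    intro y _ z _ a b ha hb hab
    simp only [smul_eq_mul]
    apply csSup_le ((oppSimplex_nonempty n A hA i).image _)
    rintro _ ⟨p, hp, rfl⟩
    have e1 : (a • y + b • z) i = a • y i + b • z i := rfl
    simp only [e1, bilin_comb]
    have h1 := le_csSup (hbdd i (y i) q hq) (Set.mem_image_of_mem _ hp)
    have h2 := le_csSup (hbdd i (z i) q hq) (Set.mem_image_of_mem _ hp)
    have h3 := add_le_add (mul_le_mul_of_nonneg_left h1 ha) (mul_le_mul_of_nonneg_left h2 hb)
    refine le_trans (le_of_eq ?_) h3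
    have : D i p q = a * D i p q + b * D i p q := by rw [← add_mul, hab, one_mul]
    linear_combination -this
  obtain ⟨π, hπ, hopt⟩ := ky_fan P hPcomp hPconv hPne
    (fun π y => ∑ i, (lossF n A R D i (y i) (restr n A π i)
      - lossF n A R D i (π i) (restr n A π i)))
    (by
      intro y hy
      apply continuousOn_finsetSum
      intro i _
      exact (hLcont i (fun _ => y i) continuous_const).sub
        (hLcont i (fun π => π i) (continuous_apply i)))
    (by
      intro π hπ
      refine ⟨hPconv, ?_⟩
      intro y hy z hz a b ha hb hab
      simp only [smul_eq_mul, mul_sum, ← sum_add_distrib]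
      apply sum_le_sum
      intro i _
      have h1 := (hLconv i _ (hPr π hπ i)).2 hy hz ha hb hab
      simp only [smul_eq_mul] at h1
      have : lossF n A R D i (π i) (restr n A π i) = a * lossF n A R D i (π i) (restr n A π i)
        + b * lossF n A R D i (π i) (restr n A π i) := by rw [← add_mul, hab, one_mul]
      linarith)
    (by intro π hπ; simp)
  refine ⟨π, (hPmem π).1 hπ, fun i x hx => ?_⟩
  have h1 := hopt (Function.update π i x) ((hPmem _).2 fun j => by
    by_cases h : j = i
    · subst h; simpa using hx
    · rw [Function.update_of_ne h]; exact (hPmem π).1 hπ j)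
  rw [Finset.sum_eq_single i] at h1
  · have hres : restr n A (Function.update π i x) i = restr n A π i := by
      funext j
      simp only [restr]
      rw [Function.update_of_ne j.2]
    have e1 : aggLoss n A R D i π = lossF n A R D i (π i) (restr n A π i) := rfl
    have e2 : aggLoss n A R D i (Function.update π i x) =
        lossF n A R D i (Function.update π i x i) (restr n A π i) := by
      rw [← hres]; rfl
    rw [e1, e2]
    linarith
  · intro j _ hj
    rw [Function.update_of_ne hj, sub_self]
  · intro h
    exact absurd (mem_univ i) h
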